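/- Let A ∈ ℝ^{pn×pn} be a symmetric positive definite weakly admissible BLR² matrix with p blocks of size n, skeleton width r ≤ n, shared bases U_0,…,U_{p−1} and skeleton blocks S_{ij}. Let U^F = blockDiag(U_0,…,U_{p−1}) ∈ ℝ^{pn×pn}. Then Â = (U^F)ᵀ · A · U^F is symmetric positive definite, its diagonal (i,i) block equals U_iᵀ A_{ii} U_i, and for every i ≠ j its off-diagonal (i,j) block equals fromBlocks 0 0 0 S_{ij} (zero except for the skeleton–skeleton block, which is S_{ij}). -/

import Mathlib

open Matrix

/-- The skeleton part `U^S` of a basis matrix: the last `r` columns, when the columns are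
indexed by `Fin q ⊕ Fin r` (`q = n - r` redundant columns followed by `r` skeleton columns). -/
def skelCols {α : Type*} {q r : ℕ} (U : Matrix α (Fin q ⊕ Fin r) ℝ) : Matrix α (Fin r) ℝ :=
  U.submatrix id Sum.inr

/-- The `(i, j)` block (of size `n × n`, `n = q + r`) of a `p × p` block matrix whose global
index type is `(Fin q ⊕ Fin r) × Fin p` (within-block index first, block index second,
matching `Matrix.blockDiagonal`). -/
def blk {q r p : ℕ}
    (A : Matrix ((Fin q ⊕ Fin r) × Fin p) ((Fin q ⊕ Fin r) × Fin p) ℝ) (i j : Fin p) :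
    Matrix (Fin q ⊕ Fin r) (Fin q ⊕ Fin r) ℝ :=
  Matrix.of fun a b => A (a, i) (b, j)

theorem blk_blockDiagonal_conj {q r p : ℕ}
    (U : Fin p → Matrix (Fin q ⊕ Fin r) (Fin q ⊕ Fin r) ℝ)
    (A : Matrix ((Fin q ⊕ Fin r) × Fin p) ((Fin q ⊕ Fin r) × Fin p) ℝ) (i j : Fin p) :
    blk ((Matrix.blockDiagonal U)ᵀ * A * Matrix.blockDiagonal U) i j =
      (U i)ᵀ * blk A i j * U j := by
  ext a b
  simp [blk, Matrix.mul_apply, Matrix.blockDiagonal_apply, Fintype.sum_prod_type]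

theorem transpose_mul_skelCols {q r : ℕ} {U : Matrix (Fin q ⊕ Fin r) (Fin q ⊕ Fin r) ℝ}
    (hU : Uᵀ * U = 1) : Uᵀ * skelCols U = Matrix.fromRows 0 1 := by
  have h : Uᵀ * skelCols U = (Uᵀ * U).submatrix id Sum.inr := rfl
  rw [h, hU]
  ext (a | a) b <;> simp [Matrix.one_apply]

/-- Let `A` be a symmetric positive definite weakly admissible BLR² matrix
with `p` blocks of size `n = q + r`, skeleton width `r`, shared orthogonal bases `U i` and
skeleton blocks `S i j` (so `A_{ij} = U_i^S S_{ij} (U_j^S)ᵀ` for `i ≠ j`).  With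
`U^F = blockDiag (U_0, …, U_{p-1})`, the matrix `Â = (U^F)ᵀ * A * U^F` is symmetric positive
definite, its diagonal `(i,i)` block is `U_iᵀ A_{ii} U_i`, and for `i ≠ j` its `(i,j)` block is
`fromBlocks 0 0 0 (S i j)`.  (Correctness of the diagonal-product step, line 2 of Algorithm 1.) -/
theorem blr2_diagonal_product {q r p : ℕ}
    (U : Fin p → Matrix (Fin q ⊕ Fin r) (Fin q ⊕ Fin r) ℝ)
    (hU : ∀ i, (U i)ᵀ * U i = 1)
    (S : Fin p → Fin p → Matrix (Fin r) (Fin r) ℝ)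
    (A : Matrix ((Fin q ⊕ Fin r) × Fin p) ((Fin q ⊕ Fin r) × Fin p) ℝ)
    (hsym : Aᵀ = A) (hpd : A.PosDef)
    (hblr : ∀ i j, i ≠ j → blk A i j = skelCols (U i) * S i j * (skelCols (U j))ᵀ)
    (Ahat : Matrix ((Fin q ⊕ Fin r) × Fin p) ((Fin q ⊕ Fin r) × Fin p) ℝ)
    (hAhat : Ahat = (Matrix.blockDiagonal U)ᵀ * A * Matrix.blockDiagonal U) :
    Ahatᵀ = Ahat ∧ Ahat.PosDef ∧
      (∀ i, blk Ahat i i = (U i)ᵀ * blk A i i * U i) ∧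
      (∀ i j, i ≠ j → blk Ahat i j = Matrix.fromBlocks 0 0 0 (S i j)) := by
  subst hAhat
  refine ⟨?_, ?_, fun i => blk_blockDiagonal_conj U A i i, fun i j hij => ?_⟩
  · simp [Matrix.transpose_mul, hsym, Matrix.mul_assoc]
  · have hinj : Function.Injective (Matrix.blockDiagonal U).mulVec := by
      refine Matrix.mulVec_injective_of_isUnit (IsUnit.of_mul_eq_one_right
        (Matrix.blockDiagonal U)ᵀ ?_)
      rw [Matrix.blockDiagonal_transpose, ← Matrix.blockDiagonal_mul]
      simp only [hU]
      exact Matrix.blockDiagonal_one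
    simpa [Matrix.conjTranspose_eq_transpose_of_trivial] using
      hpd.conjTranspose_mul_mul_same hinj
  · have h : (skelCols (U j))ᵀ * U j = ((U j)ᵀ * skelCols (U j))ᵀ := by
      rw [Matrix.transpose_mul, Matrix.transpose_transpose]
    calc blk ((Matrix.blockDiagonal U)ᵀ * A * Matrix.blockDiagonal U) i j
        = ((U i)ᵀ * skelCols (U i)) * S i j * ((skelCols (U j))ᵀ * U j) := by
          rw [blk_blockDiagonal_conj, hblr i j hij]
          simp only [Matrix.mul_assoc]
      _ = Matrix.fromBlocks 0 0 0 (S i j) := by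
          rw [h, transpose_mul_skelCols (hU i), transpose_mul_skelCols (hU j),
            Matrix.transpose_fromRows, Matrix.fromRows_mul, Matrix.fromRows_mul_fromCols]
          simp
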